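/- Let n be even, let S̄ be an F_{q^2}-subspace of F_{q^n} with dim_{F_{q^2}}(S̄) = l > 0, let b ∈ F_{q^n}^* with S̄ ∩ b·F_{q^2} = {0}, let S = S̄ ⊕ b·F_q, and suppose H(⟨S⟩_{F_{q^2}}) = F_{q^2}. Then Orb(S) ⊆ G_q(n, 2l+1) is a full weight spectrum code if and only if there exist α ∈ F_{q^n}^* and λ ∈ F_{q^n} with [F_{q^2}(λ):F_{q^2}] ≥ 2l+1 such that αS = ⟨1, λ, …, λ^{l−1}⟩_{F_{q^2}} ⊕ λ^l·F_q. -/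

import Mathlib

/-!
Setting: `q` is a prime power, realized by a finite field `Fq` with `Fintype.card Fq = q`;
`F` plays the role of `F_{q^n}`: a finite field extension of `Fq` with `Module.finrank Fq F = n`.
`F_q`-subspaces of `F_{q^n}` are `Submodule Fq F`; for a divisor `t` of `n`, the subfield
`F_{q^t}` is the (unique) `T : IntermediateField Fq F` with `Module.finrank Fq ↥T = t`, and
`F_{q^t}`-subspaces are `Submodule ↥T F`.
-/

set_option synthInstance.maxHeartbeats 1000000

namespace FWS

variable (R : Type*) {F : Type*} [Field R] [Field F] [Algebra R F]

/-- The cyclic shift `α S = {α * s : s ∈ S}` of an `R`-subspace `S` of `F`. -/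
def shift (α : F) (S : Submodule R F) : Submodule R F :=
  S.map (LinearMap.mulLeft R α)

/-- The subspace distance `d(U,V) = dim U + dim V - 2 dim (U ⊓ V)`
(which is `2k - 2 dim (U ⊓ V)` for `U, V` of the same dimension `k`). -/
noncomputable def sdist (U V : Submodule R F) : ℕ :=
  Module.finrank R ↥U + Module.finrank R ↥V - 2 * Module.finrank R ↥(U ⊓ V)

/-- The one-orbit cyclic subspace code `Orb(S) = {α S : α ∈ F*}`. -/
def orb (S : Submodule R F) : Set (Submodule R F) :=
  {T | ∃ α : F, α ≠ 0 ∧ T = shift R α S}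

/-- The weight `ω_{2i}(Orb(S)) = #{α S : α ∈ F*, d(S, α S) = 2 i}`. -/
noncomputable def omega (S : Submodule R F) (i : ℕ) : ℕ :=
  Nat.card {T : Submodule R F // T ∈ orb R S ∧ sdist R S T = 2 * i}

/-- `Orb(S)` is a full weight spectrum (FWS) code: `ω_{2i} > 0` for all `1 ≤ i ≤ dim S`. -/
def IsFWS (S : Submodule R F) : Prop :=
  ∀ i : ℕ, 1 ≤ i → i ≤ Module.finrank R ↥S → 0 < omega R S i

/-- The subspace `⟨1, l, ..., l^(k-1)⟩_R` spanned by the first `k` powers of `l`. -/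
def polySpan (l : F) (k : ℕ) : Submodule R F :=
  Submodule.span R ((fun i : ℕ => l ^ i) '' Set.Iio k)

/-- The invariant `m(Orb(S))`: the least divisor `t` of `n` such that
`dim_{F_{q^t}} ⟨S⟩_{F_{q^t}} = 1` (equivalently, the degree of the smallest subfield
containing a cyclic shift of `S`). -/
noncomputable def mOrb (S : Submodule R F) : ℕ :=
  sInf {t : ℕ | t ∣ Module.finrank R F ∧
    ∃ T : IntermediateField R F, Module.finrank R ↥T = t ∧
      Module.finrank ↥T ↥(Submodule.span ↥T (S : Set F)) = 1}

/-- The stabilizer `H(S) = {x ∈ F* : x S = S} ∪ {0}` of a set `S ⊆ F`, as a subset of `F`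
(it is a subfield of `F` when `S` is a subspace). -/
def stab {F : Type*} [Field F] (S : Set F) : Set F :=
  {x : F | x ≠ 0 ∧ (fun y => x * y) '' S = S} ∪ {0}

end FWS


namespace FWS

section Shift

variable {R F : Type*} [Field R] [Field F] [Algebra R F]

theorem mem_shift_iff {α : F} (hα : α ≠ 0) {S : Submodule R F} {x : F} :
    x ∈ shift R α S ↔ α⁻¹ * x ∈ S := by
  constructor
  · rintro ⟨y, hy, rfl⟩
    simpa [hα] using hy
  · intro h
    exact ⟨_, h, by simp [hα]⟩

theorem mul_mem_shift {α x : F} {S : Submodule R F} (hx : x ∈ S) : α * x ∈ shift R α S :=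
  ⟨x, hx, rfl⟩

theorem finrank_shift {α : F} (hα : α ≠ 0) (S : Submodule R F) :
    Module.finrank R (shift R α S) = Module.finrank R S :=
  (Submodule.equivMapOfInjective (LinearMap.mulLeft R α) (mul_right_injective₀ hα) S).symm.finrank_eq

theorem shift_shift (α β : F) (S : Submodule R F) :
    shift R α (shift R β S) = shift R (α * β) S := by
  ext x
  simp [shift]

theorem shift_one (S : Submodule R F) : shift R 1 S = S := by
  ext x
  simp [shift]

theorem shift_inv_shift {α : F} (hα : α ≠ 0) (S : Submodule R F) :
    shift R α⁻¹ (shift R α S) = S := by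
  rw [shift_shift, inv_mul_cancel₀ hα, shift_one]

theorem shift_shift_inv {α : F} (hα : α ≠ 0) (S : Submodule R F) :
    shift R α (shift R α⁻¹ S) = S := by
  rw [shift_shift, mul_inv_cancel₀ hα, shift_one]

theorem shift_mono (α : F) {S T : Submodule R F} (h : S ≤ T) : shift R α S ≤ shift R α T :=
  Submodule.map_mono h

theorem shift_sup (α : F) (S T : Submodule R F) :
    shift R α (S ⊔ T) = shift R α S ⊔ shift R α T :=
  Submodule.map_sup S T _

theorem shift_inf {α : F} (hα : α ≠ 0) (S T : Submodule R F) :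
    shift R α (S ⊓ T) = shift R α S ⊓ shift R α T := by
  ext x
  simp [mem_shift_iff hα]

theorem shift_span_singleton (α c : F) :
    shift R α (Submodule.span R {c}) = Submodule.span R {α * c} := by
  simp [shift, Submodule.map_span]

theorem finrank_sup_span_singleton_of_notMem [FiniteDimensional R F] {S : Submodule R F} {c : F}
    (hc : c ∉ S) :
    Module.finrank R ↥(S ⊔ Submodule.span R {c}) = Module.finrank R S + 1 := by
  have hc0 : c ≠ 0 := by rintro rfl; exact hc S.zero_mem
  have h := Submodule.finrank_sup_add_finrank_inf_eq S (Submodule.span R {c})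
  have hd : S ⊓ Submodule.span R {c} = ⊥ :=
    disjoint_iff.mp ((Submodule.disjoint_span_singleton' hc0).mpr hc)
  rwa [hd, finrank_bot, add_zero, finrank_span_singleton hc0] at h

theorem shift_eq_self_of_mem_range {K : Type*} [Field K] [Algebra K F] {x : K} (hx : x ≠ 0)
    (S : Submodule K F) : shift K (algebraMap K F x) S = S := by
  have hx' : algebraMap K F x ≠ 0 := by simpa using hx
  ext y
  rw [mem_shift_iff hx', ← map_inv₀, ← Algebra.smul_def]
  exact S.smul_mem_iff (inv_ne_zero hx)

end Shift

section FullWeightSpectrum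

variable {R F : Type*} [Field R] [Field F] [Algebra R F] [Finite F]

theorem isFWS_iff (S : Submodule R F) :
    IsFWS R S ↔ ∀ d < Module.finrank R S,
      ∃ α : F, α ≠ 0 ∧ Module.finrank R ↥(S ⊓ shift R α S) = d := by
  have : FiniteDimensional R F := Module.Finite.of_finite
  have key : ∀ i, 0 < omega R S i ↔ ∃ α : F, α ≠ 0 ∧
      Module.finrank R ↥(S ⊓ shift R α S) + i = Module.finrank R S := by
    intro i
    have : Finite (Submodule R F) := Finite.of_injective _ SetLike.coe_injective
    rw [omega, Nat.card_pos_iff]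
    constructor
    · rintro ⟨⟨T, ⟨α, hα, rfl⟩, hd⟩, -⟩
      refine ⟨α, hα, ?_⟩
      have hle : Module.finrank R ↥(S ⊓ shift R α S) ≤ Module.finrank R S :=
        Submodule.finrank_mono inf_le_left
      rw [sdist, finrank_shift hα] at hd
      omega
    · rintro ⟨α, hα, hd⟩
      refine ⟨⟨_, ⟨α, hα, rfl⟩, ?_⟩, inferInstance⟩
      rw [sdist, finrank_shift hα]
      omega
  simp only [IsFWS, key]
  constructor
  · intro h d hd
    obtain ⟨α, hα, h'⟩ := h (Module.finrank R S - d) (by omega) (by omega)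
    exact ⟨α, hα, by omega⟩
  · intro h i h1 h2
    obtain ⟨α, hα, h'⟩ := h (Module.finrank R S - i) (by omega)
    exact ⟨α, hα, by omega⟩

theorem isFWS_of_isFWS_shift {S : Submodule R F} {β : F} (hβ : β ≠ 0)
    (h : IsFWS R (shift R β S)) : IsFWS R S := by
  rw [isFWS_iff] at h ⊢
  intro d hd
  rw [finrank_shift hβ] at h
  obtain ⟨α, hα, h'⟩ := h d hd
  refine ⟨α, hα, ?_⟩
  rwa [shift_shift, mul_comm, ← shift_shift, ← shift_inf hβ, finrank_shift hβ] at h'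

end FullWeightSpectrum

section Tower

variable {k K F : Type*} [Field k] [Field K] [Field F] [Algebra k K] [Algebra K F] [Algebra k F]
  [IsScalarTower k K F]

theorem finrank_restrictScalars_eq_mul (X : Submodule K F) :
    Module.finrank k ↥(X.restrictScalars k) = Module.finrank k K * Module.finrank K X :=
  (Module.finrank_mul_finrank k K X).symm

theorem restrictScalars_shift (α : F) (X : Submodule K F) :
    (shift K α X).restrictScalars k = shift k α (X.restrictScalars k) := rfl

/-- An `F_q`-subspace squeezed between a hyperplane `U` and the whole of an even-dimensional
`T`-space, and of `F_q`-codimension at least three, never meets one of its shifts in dimension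
one less than that of `U`. -/
theorem finrank_inf_shift_add_one_ne [FiniteDimensional k F] [FiniteDimensional K F]
    (hev : Even (Module.finrank k K))
    {U Y : Submodule K F} (hUY : Module.finrank K Y = Module.finrank K U + 1)
    {S : Submodule k F} (hUS : U.restrictScalars k ≤ S) (hSY : S ≤ Y.restrictScalars k)
    (hS : Module.finrank k S + 3 ≤ Module.finrank k K * Module.finrank K Y)
    {α : F} (hα : α ≠ 0) :
    Module.finrank k ↥(S ⊓ shift k α S) + 1 ≠ Module.finrank k K * Module.finrank K U := by
  intro hd
  have hUY' : U ≤ Y := fun x hx => hSY (hUS hx)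
  have hUα : (shift K α U).restrictScalars k ≤ shift k α S := shift_mono α hUS
  have hYα : shift k α S ≤ (shift K α Y).restrictScalars k := shift_mono α hSY
  have hne : shift K α U ≠ U := by
    intro h
    rw [h] at hUα
    have := Submodule.finrank_mono (le_inf hUS hUα)
    rw [finrank_restrictScalars_eq_mul] at this
    omega
  have hsum := Submodule.finrank_sup_add_finrank_inf_eq S (shift k α S)
  rw [finrank_shift hα] at hsum
  have hyper : ∀ Z : Submodule K F, Z ≤ Y → ¬ Z ≤ U → U ⊔ Z = Y := by
    intro Z hZ hZU
    refine Submodule.eq_of_le_of_finrank_le (sup_le hUY' hZ) ?_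
    have : U < U ⊔ Z := left_lt_sup.mpr hZU
    have := Submodule.finrank_lt_finrank_of_lt this
    omega
  have hle_eq : ∀ {A B : Submodule K F}, A ≤ B → Module.finrank K A = Module.finrank K B →
      A = B := fun h h' => Submodule.eq_of_le_of_finrank_eq h h'
  by_cases hY : shift K α Y = Y
  · have hnle : ¬ shift K α U ≤ U := fun h => hne (hle_eq h (finrank_shift hα U))
    have hsup : U ⊔ shift K α U = Y := hyper _ (by rw [← hY]; exact shift_mono α hUY') hnle
    have hSS : S ⊔ shift k α S = Y.restrictScalars k := by
      apply le_antisymm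
      · exact sup_le hSY (by rwa [hY] at hYα)
      · rw [← hsup, Submodule.restrictScalars_sup]
        exact sup_le_sup hUS hUα
    rw [hSS, finrank_restrictScalars_eq_mul] at hsum
    have h1 := hev.mul_right (Module.finrank K Y)
    have h2 := hev.mul_right (Module.finrank K U)
    grind
  · have hWlt : Y ⊓ shift K α Y < Y := by
      refine lt_of_le_of_ne inf_le_left fun h => hY ?_
      exact (hle_eq (inf_eq_left.mp h) (finrank_shift hα Y).symm).symm
    have hWr := Submodule.finrank_lt_finrank_of_lt hWlt
    have hSW : S ⊓ shift k α S ≤ (Y ⊓ shift K α Y).restrictScalars k := inf_le_inf hSY hYα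
    have hSWr := Submodule.finrank_mono hSW
    rw [finrank_restrictScalars_eq_mul] at hSWr
    obtain ⟨e, he⟩ := hev
    have hpos : 0 < Module.finrank k K := by
      by_contra h0
      have : Module.finrank k K = 0 := by omega
      rw [this] at hS
      omega
    have hW : Module.finrank K ↥(Y ⊓ shift K α Y) = Module.finrank K U := by
      by_contra hcon
      have : Module.finrank K ↥(Y ⊓ shift K α Y) + 1 ≤ Module.finrank K U := by omega
      have := Nat.mul_le_mul_left (Module.finrank k K) this
      rw [Nat.mul_add] at this
      omega
    have hcodim : ∀ S' : Submodule k F, Module.finrank k S' = Module.finrank k S →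
        S ⊓ shift k α S ≤ S' →
        ∀ Y' : Submodule K F, Module.finrank K Y' = Module.finrank K Y →
        (S' ⊔ (Y ⊓ shift K α Y).restrictScalars k) ≠ Y'.restrictScalars k := by
      intro S' hS' hle Y' hY' heq
      have h1 := Submodule.finrank_sup_add_finrank_inf_eq S'
        ((Y ⊓ shift K α Y).restrictScalars k)
      have h2 := Submodule.finrank_mono (le_inf hle hSW)
      rw [heq, finrank_restrictScalars_eq_mul, finrank_restrictScalars_eq_mul, hW, hY', hS'] at h1
      omega
    have hWU : Y ⊓ shift K α Y = U := by
      refine hle_eq ?_ hW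
      by_contra hn
      refine hcodim S rfl inf_le_left Y rfl (le_antisymm (sup_le hSY ?_) ?_)
      · exact fun x hx => hx.1
      · have h := sup_le_sup_right hUS ((Y ⊓ shift K α Y).restrictScalars k)
        rwa [← Submodule.restrictScalars_sup, hyper _ inf_le_left hn] at h
    refine hne (hle_eq ?_ (finrank_shift hα U))
    by_contra hn
    have hsup : shift K α U ⊔ U = shift K α Y := by
      refine Submodule.eq_of_le_of_finrank_le
        (sup_le (shift_mono α hUY') (hWU ▸ inf_le_right)) ?_
      have : U < shift K α U ⊔ U := right_lt_sup.mpr hn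
      have := Submodule.finrank_lt_finrank_of_lt this
      rw [finrank_shift hα]
      omega
    refine hcodim (shift k α S) (finrank_shift hα S) inf_le_right (shift K α Y)
      (finrank_shift hα Y) (le_antisymm (sup_le hYα ?_) ?_)
    · exact fun x hx => hx.2
    · rw [hWU, ← hsup, Submodule.restrictScalars_sup]
      exact sup_le_sup_right hUα _

end Tower

section Chain

variable {K F : Type*} [Field K] [Field F] [Algebra K F]

theorem pow_mem_polySpan (l : F) {i r : ℕ} (h : i < r) : l ^ i ∈ polySpan K l r :=
  Submodule.subset_span ⟨i, h, rfl⟩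

theorem polySpan_le_iff {l : F} {r : ℕ} {X : Submodule K F} :
    polySpan K l r ≤ X ↔ ∀ i < r, l ^ i ∈ X := by
  simp [polySpan, Submodule.span_le, Set.subset_def]

theorem polySpan_succ (l : F) (r : ℕ) :
    polySpan K l (r + 1) = polySpan K l r ⊔ Submodule.span K {l ^ r} := by
  apply le_antisymm
  · rw [polySpan_le_iff]
    intro i hi
    rcases Nat.lt_succ_iff_lt_or_eq.mp hi with h | rfl
    · exact Submodule.mem_sup_left (pow_mem_polySpan l h)
    · exact Submodule.mem_sup_right (Submodule.mem_span_singleton_self _)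
  · refine sup_le (polySpan_le_iff.mpr fun i hi => pow_mem_polySpan l (by omega)) ?_
    rw [Submodule.span_singleton_le_iff_mem]
    exact pow_mem_polySpan l (Nat.lt_succ_self r)

theorem polySpan_sup_shift_polySpan (l : F) (r : ℕ) :
    polySpan K l (r + 1) ⊔ shift K l (polySpan K l (r + 1)) = polySpan K l (r + 2) := by
  apply le_antisymm
  · refine sup_le (polySpan_le_iff.mpr fun i hi => pow_mem_polySpan l (by omega)) ?_
    rw [shift, Submodule.map_le_iff_le_comap, polySpan_le_iff]
    intro i hi
    simpa [pow_succ'] using pow_mem_polySpan (K := K) l (show i + 1 < r + 2 by omega)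
  · rw [polySpan_le_iff]
    rintro (_ | i) hi
    · exact Submodule.mem_sup_left (pow_mem_polySpan l (Nat.succ_pos r))
    · rw [pow_succ']
      exact Submodule.mem_sup_right (mul_mem_shift (pow_mem_polySpan l (by omega)))

/-- If `λ` maps a hyperplane `B` of `V` into `V`, then `V` is the sum of a `λ`-invariant subspace
of `B` and of a geometric progression of ratio `λ`, whose last term generates `V` over `B`. -/
theorem exists_eq_sup_shift_polySpan [FiniteDimensional K F] {l : F} (hl : l ≠ 0) :
    ∀ (d : ℕ) (B V : Submodule K F), Module.finrank K B = d → Module.finrank K V = d + 1 →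
      B ≤ V → shift K l B ≤ V →
      ∃ (U : Submodule K F) (c : F) (r : ℕ), shift K l U = U ∧ d = Module.finrank K U + r ∧
        B = U ⊔ shift K c (polySpan K l r) ∧ V = U ⊔ shift K c (polySpan K l (r + 1)) := by
  have base : ∀ (d : ℕ) (B V : Submodule K F), Module.finrank K B = d →
      Module.finrank K V = d + 1 → B ≤ V → shift K l B = B →
      ∃ (U : Submodule K F) (c : F) (r : ℕ), shift K l U = U ∧ d = Module.finrank K U + r ∧
        B = U ⊔ shift K c (polySpan K l r) ∧ V = U ⊔ shift K c (polySpan K l (r + 1)) := by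
    intro d B V hB hV hBV hlB
    have hlt : B < V := lt_of_le_of_ne hBV (by rintro rfl; omega)
    obtain ⟨c, hcV, hcB⟩ := SetLike.exists_of_lt hlt
    have h0 : polySpan K l 0 = ⊥ := by simp [polySpan]
    have h1 : polySpan K l (0 + 1) = Submodule.span K {1} := by
      rw [polySpan_succ, h0, bot_sup_eq, pow_zero]
    refine ⟨B, c, 0, hlB, by omega, ?_, ?_⟩
    · simp [h0, shift]
    · rw [h1, shift_span_singleton, mul_one]
      symm
      apply Submodule.eq_of_le_of_finrank_le
      · exact sup_le hBV (by simpa using hcV)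
      · rw [finrank_sup_span_singleton_of_notMem hcB, hV, hB]
  intro d
  induction d with
  | zero =>
    intro B V hB hV hBV _
    refine base 0 B V hB hV hBV ?_
    rw [Submodule.finrank_eq_zero] at hB
    simp [hB, shift]
  | succ d ih =>
    intro B V hB hV hBV hlB
    by_cases hinv : shift K l B = B
    · exact base _ B V hB hV hBV hinv
    have hsup : B ⊔ shift K l B = V := by
      apply Submodule.eq_of_le_of_finrank_le (sup_le hBV hlB)
      have hlt : B < B ⊔ shift K l B := left_lt_sup.mpr fun h =>
        hinv (Submodule.eq_of_le_of_finrank_eq h (finrank_shift hl B))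
      have := Submodule.finrank_lt_finrank_of_lt hlt
      omega
    have hdim := Submodule.finrank_sup_add_finrank_inf_eq B (shift K l B)
    rw [hsup, finrank_shift hl] at hdim
    have hli : l⁻¹ ≠ 0 := inv_ne_zero hl
    obtain ⟨U, c, r, hU, hd, hB', hBU⟩ := ih (shift K l⁻¹ (B ⊓ shift K l B)) B
      (by rw [finrank_shift hli]; omega) hB
      (by rw [shift_inf hli, shift_inv_shift hl]; exact inf_le_right)
      (by rw [shift_shift_inv hl]; exact inf_le_left)
    refine ⟨U, c, r + 1, hU, by omega, hBU, ?_⟩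
    rw [← hsup, ← polySpan_sup_shift_polySpan, shift_sup, shift_shift, mul_comm c l,
      ← shift_shift]
    conv_lhs => rw [hBU, shift_sup, hU]
    rw [sup_sup_sup_comm, sup_idem]

end Chain

section Tower

variable {k K F : Type*} [Field k] [Field K] [Field F] [Algebra k K] [Algebra K F] [Algebra k F]
  [IsScalarTower k K F]

theorem exists_notMem_range_algebraMap (h2 : Module.finrank k K = 2) :
    ∃ μ : K, μ ∉ Set.range (algebraMap k K) := by
  by_contra! h
  have := (Subalgebra.bot_eq_top_iff_finrank_eq_one (F := k) (E := K)).mp (by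
    rw [eq_top_iff]
    exact fun x _ => Algebra.mem_bot.mpr (h x))
  omega

/-- If some shift of `S = S̄ ⊕ b F_q` meets `S` in codimension two, then some `λ` maps `S̄` into
its `F_{q^2}`-span `S̄ ⊕ b F_{q^2}` without fixing it. -/
theorem exists_shift_le_of_finrank_inf_shift_add_two [FiniteDimensional k F]
    [FiniteDimensional K F] (h2 : Module.finrank k K = 2) {B : Submodule K F} {b : F} (hb : b ∉ B)
    (hH : ∀ x : F, x ≠ 0 → shift K x (B ⊔ Submodule.span K {b}) = B ⊔ Submodule.span K {b} →
      x ∈ Set.range (algebraMap K F))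
    {S : Submodule k F} (hS : S = B.restrictScalars k ⊔ Submodule.span k {b})
    {α : F} (hα : α ≠ 0)
    (hd : Module.finrank k ↥(S ⊓ shift k α S) + 1 = 2 * Module.finrank K B) :
    ∃ l : F, l ≠ 0 ∧ shift K l B ≤ B ⊔ Submodule.span K {b} ∧ shift K l B ≠ B := by
  set V := B ⊔ Submodule.span K {b} with hV
  have hVr : Module.finrank K V = Module.finrank K B + 1 :=
    finrank_sup_span_singleton_of_notMem hb
  have hBS : B.restrictScalars k ≤ S := hS ▸ le_sup_left
  have hBV : B ≤ V := le_sup_left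
  obtain ⟨φ, hφB, hφb⟩ := LinearMap.exists_extend_of_notMem (0 : B →ₗ[K] K) hb 1
  replace hφB : ∀ x ∈ B, φ x = 0 := fun x hx => by
    simpa using LinearMap.congr_fun hφB ⟨x, hx⟩
  have hkerB : ∀ x ∈ V, φ x = 0 → x ∈ B := by
    intro x hx h
    obtain ⟨y, hy, z, hz, rfl⟩ := Submodule.mem_sup.mp hx
    obtain ⟨a, rfl⟩ := Submodule.mem_span_singleton.mp hz
    simp [hφB y hy, hφb] at h
    simpa [h] using hy
  have hmemS : ∀ x ∈ V, x ∈ S ↔ φ x ∈ Set.range (algebraMap k K) := by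
    intro x hx
    rw [hS]
    constructor
    · intro h
      obtain ⟨y, hy, z, hz, rfl⟩ := Submodule.mem_sup.mp h
      obtain ⟨a, rfl⟩ := Submodule.mem_span_singleton.mp hz
      refine ⟨a, ?_⟩
      rw [map_add, hφB y hy, ← algebraMap_smul K a b, map_smul, hφb]
      simp
    · rintro ⟨a, ha⟩
      rw [← sub_add_cancel x (a • b)]
      refine Submodule.add_mem_sup ?_ (Submodule.smul_mem _ _ (Submodule.mem_span_singleton_self b))
      have hab : a • b = algebraMap k K a • b := (algebraMap_smul K a b).symm
      refine hkerB _ (V.sub_mem hx ?_) ?_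
      · rw [hab]
        exact V.smul_mem _ (Submodule.mem_sup_right (Submodule.mem_span_singleton_self b))
      · rw [map_sub, hab, map_smul, hφb, ← ha]
        simp
  have hSV : S ≤ V.restrictScalars k := by
    rw [hS]
    refine sup_le hBV ?_
    rw [Submodule.span_singleton_le_iff_mem]
    exact Submodule.mem_sup_right (Submodule.mem_span_singleton_self b)
  have hαB : shift K α B ≠ B := by
    intro h
    have h' : B.restrictScalars k ≤ S ⊓ shift k α S :=
      le_inf hBS (by conv_lhs => rw [← h]
                     exact shift_mono α hBS)
    have := Submodule.finrank_mono h'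
    rw [finrank_restrictScalars_eq_mul, h2] at this
    omega
  have hαK : α ∉ Set.range (algebraMap K F) := by
    rintro ⟨x, rfl⟩
    exact hαB (shift_eq_self_of_mem_range (by simpa using hα) B)
  set W := V ⊓ shift K α V with hW
  have hWSS : S ⊓ shift k α S ≤ W.restrictScalars k := inf_le_inf hSV (shift_mono α hSV)
  have hWr : Module.finrank K W = Module.finrank K B := by
    have hlt : W < V := by
      refine lt_of_le_of_ne inf_le_left fun h => hαK (hH α hα ?_)
      exact (Submodule.eq_of_le_of_finrank_eq (inf_eq_left.mp h) (finrank_shift hα V).symm).symm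
    have h1 := Submodule.finrank_lt_finrank_of_lt hlt
    have h3 := Submodule.finrank_mono hWSS
    rw [finrank_restrictScalars_eq_mul, h2] at h3
    omega
  have hWV : W ≤ V := inf_le_left
  have hαW : ∀ w ∈ W, α⁻¹ * w ∈ V := fun w hw => (mem_shift_iff hα).mp hw.2
  by_cases hφW : ∀ w ∈ W, φ w = 0
  · have hWB : W = B :=
      Submodule.eq_of_le_of_finrank_eq (fun w hw => hkerB w (hWV hw) (hφW w hw)) hWr
    refine ⟨α⁻¹, inv_ne_zero hα, ?_, fun h => hαB ?_⟩
    · rintro _ ⟨x, hx, rfl⟩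
      exact hαW x (hWB ▸ hx)
    · conv_lhs => rw [← h]
      exact shift_shift_inv hα B
  by_cases hψW : ∀ w ∈ W, φ (α⁻¹ * w) = 0
  · have hWB : W = shift K α B := by
      refine Submodule.eq_of_le_of_finrank_eq (fun w hw => ?_) (by rw [hWr, finrank_shift hα])
      exact (mem_shift_iff hα).mpr (hkerB _ (hαW w hw) (hψW w hw))
    exact ⟨α, hα, hWB ▸ hWV, hαB⟩
  obtain ⟨μ, hμ⟩ := exists_notMem_range_algebraMap h2
  have hcut : ∀ S' : Submodule k F, S ⊓ shift k α S ≤ S' → ¬ W.restrictScalars k ≤ S' →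
      W.restrictScalars k ⊓ S' = S ⊓ shift k α S := by
    intro S' hS' hWS'
    symm
    apply Submodule.eq_of_le_of_finrank_le (le_inf hWSS hS')
    have hlt : W.restrictScalars k ⊓ S' < W.restrictScalars k := inf_lt_left.mpr hWS'
    have := Submodule.finrank_lt_finrank_of_lt hlt
    rw [finrank_restrictScalars_eq_mul, h2, hWr] at this
    omega
  have hscale : ∀ f : F →ₗ[K] K, (¬ ∀ w ∈ W, f w = 0) → ∀ x : K, ∃ w ∈ W, f w = x := by
    intro f hf x
    push Not at hf
    obtain ⟨w, hw, hfw⟩ := hf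
    refine ⟨(x / f w) • w, W.smul_mem _ hw, ?_⟩
    rw [map_smul, smul_eq_mul, div_mul_cancel₀ _ hfw]
  have hψmem : ∀ w ∈ W, w ∈ shift k α S ↔ φ (α⁻¹ * w) ∈ Set.range (algebraMap k K) :=
    fun w hw => (mem_shift_iff hα).trans (hmemS _ (hαW w hw))
  have hiff : ∀ w ∈ W, φ w ∈ Set.range (algebraMap k K) →
      φ (α⁻¹ * w) ∈ Set.range (algebraMap k K) := by
    have h1 := hcut S inf_le_left (by
      obtain ⟨w, hw, hwμ⟩ := hscale φ hφW μ
      exact fun h => hμ (hwμ ▸ (hmemS w (hWV hw)).mp (h hw)))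
    intro w hw hφw
    have : w ∈ W.restrictScalars k ⊓ S := ⟨hw, (hmemS w (hWV hw)).mpr hφw⟩
    rw [h1] at this
    exact (hψmem w hw).mp this.2
  have hker : ∀ w ∈ W, φ w = 0 → φ (α⁻¹ * w) = 0 := by
    intro w hw hφw
    by_contra hne
    refine hμ ?_
    have := hiff ((μ / φ (α⁻¹ * w)) • w) (W.smul_mem _ hw)
      (by rw [map_smul, hφw, smul_zero]; exact ⟨0, map_zero _⟩)
    rwa [mul_smul_comm, map_smul, smul_eq_mul, div_mul_cancel₀ _ hne] at this
  obtain ⟨w₀, hw₀, hφw₀⟩ := hscale φ hφW 1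
  set c := φ (α⁻¹ * w₀) with hc
  have hprop : ∀ w ∈ W, φ ((α⁻¹ - algebraMap K F c) * w) = 0 := by
    intro w hw
    have h := hker (w - φ w • w₀) (W.sub_mem hw (W.smul_mem _ hw₀))
      (by rw [map_sub, map_smul, hφw₀]; simp)
    rw [mul_sub, mul_smul_comm, map_sub, map_smul, ← hc] at h
    rw [sub_mul, ← Algebra.smul_def, map_sub, map_smul, smul_eq_mul, mul_comm c]
    exact h
  have hne : α⁻¹ - algebraMap K F c ≠ 0 := by
    intro h
    refine hαK ⟨c⁻¹, ?_⟩
    rw [map_inv₀, ← sub_eq_zero.mp h, inv_inv]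
  have hWB : shift K (α⁻¹ - algebraMap K F c) W = B := by
    refine Submodule.eq_of_le_of_finrank_eq ?_ (by rw [finrank_shift hne, hWr])
    rintro _ ⟨w, hw, rfl⟩
    refine hkerB _ ?_ (hprop w hw)
    change (α⁻¹ - algebraMap K F c) * w ∈ V
    rw [sub_mul, ← Algebra.smul_def]
    exact V.sub_mem (hαW w hw) (V.smul_mem _ (hWV hw))
  have hBW : shift K (α⁻¹ - algebraMap K F c)⁻¹ B = W := by
    rw [← hWB, shift_inv_shift hne]
  refine ⟨_, inv_ne_zero hne, hBW ▸ hWV, fun h => hφW fun w hw => hφB w ?_⟩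
  rwa [← h, hBW]

end Tower

section Polynomial

open Polynomial

variable {K F : Type*} [Field K] [Field F] [Algebra K F]

theorem mem_degreeLT_iff_coeff {n : ℕ} {p : K[X]} :
    p ∈ degreeLT K n ↔ ∀ i, n ≤ i → p.coeff i = 0 := by
  rw [mem_degreeLT, degree_lt_iff_coeff_zero]

theorem mem_polySpan_iff {l : F} {m : ℕ} {x : F} :
    x ∈ polySpan K l m ↔ ∃ p ∈ degreeLT K m, aeval l p = x := by
  classical
  have : polySpan K l m = (degreeLT K m).map (aeval l).toLinearMap := by
    rw [degreeLT_eq_span_X_pow, Submodule.map_span, polySpan]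
    congr 1
    ext y
    simp
  rw [this]
  simp

theorem eq_of_aeval_eq_of_mem_degreeLT [FiniteDimensional K F] {l : F} {N : ℕ}
    (hN : N ≤ Module.finrank K (IntermediateField.adjoin K {l})) {p r : K[X]}
    (hp : p ∈ degreeLT K N) (hr : r ∈ degreeLT K N) (h : aeval l p = aeval l r) : p = r := by
  have hint : IsIntegral K l := Algebra.IsIntegral.isIntegral l
  rw [IntermediateField.adjoin.finrank hint] at hN
  by_contra hne
  have h0 : p - r ≠ 0 := sub_ne_zero.mpr hne
  have hle := minpoly.degree_le_of_ne_zero K l h0 (by rw [map_sub, h, sub_self])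
  have hlt := mem_degreeLT.mp ((degreeLT K N).sub_mem hp hr)
  rw [degree_eq_natDegree (minpoly.ne_zero hint)] at hle
  exact absurd (hle.trans_lt hlt) (by simpa using hN)

theorem X_pow_mem_degreeLT {m N : ℕ} (h : m < N) : (X ^ m : K[X]) ∈ degreeLT K N :=
  mem_degreeLT.mpr (by rw [degree_X_pow]; exact_mod_cast h)

theorem pow_notMem_polySpan [FiniteDimensional K F] {l : F} {m : ℕ}
    (hm : m < Module.finrank K (IntermediateField.adjoin K {l})) : l ^ m ∉ polySpan K l m := by
  rw [mem_polySpan_iff]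
  rintro ⟨p, hp, hpx⟩
  have := eq_of_aeval_eq_of_mem_degreeLT hm (degreeLT_mono (Nat.le_succ m) hp)
    (X_pow_mem_degreeLT (Nat.lt_succ_self m)) (by simpa using hpx)
  have hc := mem_degreeLT_iff_coeff.mp hp m le_rfl
  simp [this] at hc

theorem finrank_polySpan [FiniteDimensional K F] {l : F} {m : ℕ}
    (hm : m ≤ Module.finrank K (IntermediateField.adjoin K {l})) :
    Module.finrank K (polySpan K l m) = m := by
  induction m with
  | zero =>
    have : polySpan K l 0 = ⊥ := by simp [polySpan]
    rw [this, finrank_bot]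
  | succ m ih =>
    rw [polySpan_succ, finrank_sup_span_singleton_of_notMem (pow_notMem_polySpan hm), ih (by omega)]

variable {k : Type*} [Field k] [Algebra k K]

theorem eq_zero_of_mul_mem_range {μ a : K} (hμ : μ ∉ Set.range (algebraMap k K))
    (ha : a ∈ Set.range (algebraMap k K)) (h : μ * a ∈ Set.range (algebraMap k K)) : a = 0 := by
  by_contra h0
  obtain ⟨x, rfl⟩ := ha
  obtain ⟨y, hy⟩ := h
  refine hμ ⟨y / x, ?_⟩
  rw [map_div₀, hy, mul_div_cancel_right₀ _ h0]

theorem one_add_smul_pow_ne_zero [FiniteDimensional K F] {l : F} {μ : K}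
    (hμ : μ ∉ Set.range (algebraMap k K)) {j : ℕ}
    (hj : j < Module.finrank K (IntermediateField.adjoin K {l})) :
    1 + μ • l ^ j ≠ 0 := by
  intro h
  have h0 : (1 + μ • X ^ j : K[X]) = 0 := by
    refine eq_of_aeval_eq_of_mem_degreeLT hj ?_ (Submodule.zero_mem _) (by simpa using h)
    refine Submodule.add_mem _ ?_ (Submodule.smul_mem _ _ (X_pow_mem_degreeLT (by omega)))
    simpa using X_pow_mem_degreeLT (K := K) (Nat.succ_pos j)
  have hc := congrArg (fun p => coeff p 0) h0
  rcases j.eq_zero_or_pos with rfl | hj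
  · simp at hc
    exact hμ ⟨-1, by simpa [eq_comm] using eq_neg_of_add_eq_zero_right hc⟩
  · simp [coeff_X_pow, hj.ne] at hc

end Polynomial

section Tower

open Polynomial

variable (k : Type*) {K F : Type*} [Field k] [Field K] [Field F] [Algebra k K] [Algebra K F]
  [Algebra k F] [IsScalarTower k K F]

/-- The subspace `⟨1, λ, …, λ^(m-1)⟩_K ⊕ λ^m k`. -/
def polySpanLine (K : Type*) [Field K] [Algebra k K] [Algebra K F] [IsScalarTower k K F]
    (l : F) (m : ℕ) : Submodule k F :=
  (polySpan K l m).restrictScalars k ⊔ Submodule.span k {l ^ m}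

variable {k}

theorem mem_polySpanLine_iff {l : F} {m : ℕ} {x : F} :
    x ∈ polySpanLine k K l m ↔
      ∃ p ∈ degreeLT K (m + 1), p.coeff m ∈ Set.range (algebraMap k K) ∧ aeval l p = x := by
  rw [polySpanLine]
  constructor
  · intro h
    obtain ⟨y, hy, z, hz, rfl⟩ := Submodule.mem_sup.mp h
    obtain ⟨a, rfl⟩ := Submodule.mem_span_singleton.mp hz
    obtain ⟨p, hp, rfl⟩ := mem_polySpan_iff.mp hy
    refine ⟨p + algebraMap k K a • X ^ m, ?_, ⟨a, ?_⟩, ?_⟩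
    · exact Submodule.add_mem _ (degreeLT_mono (Nat.le_succ m) hp)
        (Submodule.smul_mem _ _ (X_pow_mem_degreeLT (Nat.lt_succ_self m)))
    · rw [coeff_add, mem_degreeLT_iff_coeff.mp hp m le_rfl, coeff_smul, coeff_X_pow_self, zero_add,
        smul_eq_mul, mul_one]
    · rw [map_add, map_smul, map_pow, aeval_X, algebraMap_smul]
  · rintro ⟨p, hp, ⟨a, ha⟩, rfl⟩
    have hsplit : aeval l p = aeval l (p - p.coeff m • X ^ m) + a • l ^ m := by
      rw [map_sub, map_smul, map_pow, aeval_X, ← ha, algebraMap_smul, sub_add_cancel]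
    rw [hsplit]
    refine Submodule.add_mem_sup (mem_polySpan_iff.mpr ⟨_, ?_, rfl⟩)
      (Submodule.smul_mem _ _ (Submodule.mem_span_singleton_self _))
    rw [mem_degreeLT_iff_coeff] at hp ⊢
    intro i hi
    rcases hi.eq_or_lt with rfl | hi
    · simp
    · simp [hp i hi, coeff_X_pow, hi.ne']

theorem finrank_polySpanLine [FiniteDimensional k F] [FiniteDimensional K F] {l : F} {m : ℕ}
    (hm : m < Module.finrank K (IntermediateField.adjoin K {l})) :
    Module.finrank k (polySpanLine k K l m) = Module.finrank k K * m + 1 := by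
  rw [polySpanLine, finrank_sup_span_singleton_of_notMem (S := (polySpan K l m).restrictScalars k)
    (pow_notMem_polySpan hm), finrank_restrictScalars_eq_mul, finrank_polySpan hm.le]

theorem polySpan_le_polySpanLine {l : F} {m : ℕ} :
    (polySpan K l m).restrictScalars k ≤ polySpanLine k K l m := le_sup_left

theorem polySpanLine_inf_shift_pow [FiniteDimensional K F] {l : F} {m j : ℕ}
    (hm : 2 * m + 1 ≤ Module.finrank K (IntermediateField.adjoin K {l})) (hj : 0 < j)
    (hjm : j ≤ m) :
    polySpanLine k K l m ⊓ shift k (l ^ j) (polySpanLine k K l m) =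
      shift k (l ^ j) (polySpanLine k K l (m - j)) := by
  apply le_antisymm
  · rintro _ ⟨hx, y, hy, rfl⟩
    obtain ⟨p, hp, hpm, hpx⟩ := mem_polySpanLine_iff.mp hx
    obtain ⟨r, hr, hrm, rfl⟩ := mem_polySpanLine_iff.mp hy
    refine mul_mem_shift (mem_polySpanLine_iff.mpr ⟨r, ?_, ?_, rfl⟩)
    all_goals
      rw [mem_degreeLT_iff_coeff] at hp hr
      have hpr : p = X ^ j * r := by
        refine eq_of_aeval_eq_of_mem_degreeLT hm ?_ ?_ (by simpa using hpx)
        · exact mem_degreeLT_iff_coeff.mpr fun i hi => hp i (by omega)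
        · refine mem_degreeLT_iff_coeff.mpr fun i hi => ?_
          rw [coeff_X_pow_mul', if_pos (by omega)]
          exact hr _ (by omega)
      have hco : ∀ i, r.coeff i = p.coeff (i + j) := fun i => by rw [hpr, coeff_X_pow_mul]
    · refine mem_degreeLT_iff_coeff.mpr fun i hi => ?_
      rw [hco]
      exact hp _ (by omega)
    · rwa [hco, Nat.sub_add_cancel hjm]
  · refine le_inf ?_ (shift_mono _ ?_)
    · rintro _ ⟨y, hy, rfl⟩
      obtain ⟨r, hr, hrm, rfl⟩ := mem_polySpanLine_iff.mp hy
      rw [mem_degreeLT_iff_coeff] at hr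
      refine mem_polySpanLine_iff.mpr ⟨X ^ j * r, ?_, ?_, by simp⟩
      · refine mem_degreeLT_iff_coeff.mpr fun i hi => ?_
        rw [coeff_X_pow_mul', if_pos (by omega)]
        exact hr _ (by omega)
      · rwa [coeff_X_pow_mul', if_pos hjm]
    · intro x hx
      obtain ⟨r, hr, -, rfl⟩ := mem_polySpanLine_iff.mp hx
      exact polySpan_le_polySpanLine
        (mem_polySpan_iff.mpr ⟨r, degreeLT_mono (by omega) hr, rfl⟩)

theorem polySpanLine_inf_shift_div [FiniteDimensional K F] {l : F} (hl0 : l ≠ 0) {μ : K}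
    (hμ : μ ∉ Set.range (algebraMap k K)) {m j : ℕ}
    (hm : 2 * m + 1 ≤ Module.finrank K (IntermediateField.adjoin K {l})) (hjm : j ≤ m) :
    polySpanLine k K l m ⊓ shift k (l ^ j / (1 + μ • l ^ j)) (polySpanLine k K l m) =
      shift k (l ^ j) ((polySpan K l (m - j)).restrictScalars k) := by
  have hne : 1 + μ • l ^ j ≠ 0 := one_add_smul_pow_ne_zero hμ (by omega)
  have hα : l ^ j / (1 + μ • l ^ j) ≠ 0 := div_ne_zero (pow_ne_zero _ hl0) hne
  apply le_antisymm
  · rintro _ ⟨hx, y, hy, rfl⟩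
    obtain ⟨p, hp, hpm, hpx⟩ := mem_polySpanLine_iff.mp hx
    obtain ⟨r, hr, hrm, rfl⟩ := mem_polySpanLine_iff.mp hy
    rw [mem_degreeLT_iff_coeff] at hp hr
    rw [LinearMap.mulLeft_apply] at hpx ⊢
    have hpr : p = X ^ j * (r - μ • p) := by
      refine eq_of_aeval_eq_of_mem_degreeLT hm ?_ ?_ ?_
      · exact mem_degreeLT_iff_coeff.mpr fun i hi => hp i (by omega)
      · refine mem_degreeLT_iff_coeff.mpr fun i hi => ?_
        rw [coeff_X_pow_mul', if_pos (by omega), coeff_sub, coeff_smul, hr _ (by omega),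
          hp _ (by omega), smul_zero, sub_zero]
      · have hpx' : (1 + μ • l ^ j) * aeval l p = l ^ j * aeval l r := by
          rw [hpx]
          field_simp
        simp only [map_mul, map_sub, map_smul, map_pow, aeval_X, mul_sub, ← hpx']
        simp only [Algebra.smul_def]
        ring
    set h := r - μ • p with hh
    have hco : ∀ i, h.coeff i = p.coeff (i + j) := fun i => by
      conv_rhs => rw [hpr]
      rw [coeff_X_pow_mul]
    have hpm0 : p.coeff m = 0 := by
      have hrr : r.coeff m = h.coeff m + μ * p.coeff m := by simp [hh]
      rw [hrr, hco] at hrm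
      rcases j.eq_zero_or_pos with rfl | hj
      · refine eq_zero_of_mul_mem_range hμ hpm ?_
        obtain ⟨x, hx⟩ := hpm
        obtain ⟨y, hy⟩ := hrm
        refine ⟨y - x, ?_⟩
        rw [map_sub, hx, hy]
        simp
      · rw [hp _ (by omega), zero_add] at hrm
        exact eq_zero_of_mul_mem_range hμ hpm hrm
    refine ⟨aeval l h, mem_polySpan_iff.mpr ⟨h, ?_, rfl⟩, ?_⟩
    · refine mem_degreeLT_iff_coeff.mpr fun i hi => ?_
      rw [hco]
      rcases Nat.eq_or_lt_of_le (show m ≤ i + j by omega) with h' | h'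
      · rw [← h', hpm0]
      · exact hp _ h'
    · rw [LinearMap.mulLeft_apply, ← hpx]
      conv_rhs => rw [hpr]
      simp
  · rintro _ ⟨y, hy, rfl⟩
    obtain ⟨p, hp, rfl⟩ := mem_polySpan_iff.mp hy
    rw [LinearMap.mulLeft_apply]
    have hXp : X ^ j * p ∈ degreeLT K m := by
      rw [mem_degreeLT_iff_coeff] at hp ⊢
      intro i hi
      rw [coeff_X_pow_mul', if_pos (by omega)]
      exact hp _ (by omega)
    refine ⟨polySpan_le_polySpanLine (mem_polySpan_iff.mpr ⟨_, hXp, by simp⟩), ?_⟩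
    rw [SetLike.mem_coe, mem_shift_iff hα]
    refine polySpan_le_polySpanLine (mem_polySpan_iff.mpr ⟨p + μ • (X ^ j * p),
      Submodule.add_mem _ (degreeLT_mono (by omega) hp) (Submodule.smul_mem _ _ hXp), ?_⟩)
    have := pow_ne_zero j hl0
    simp only [map_add, map_smul, map_mul, map_pow, aeval_X]
    simp only [Algebra.smul_def] at hne ⊢
    field_simp

theorem isFWS_polySpanLine [Finite F] [FiniteDimensional k F] [FiniteDimensional K F]
    (h2 : Module.finrank k K = 2) {l : F} {m : ℕ} (hm0 : 0 < m)
    (hm : 2 * m + 1 ≤ Module.finrank K (IntermediateField.adjoin K {l})) :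
    IsFWS k (polySpanLine k K l m) := by
  obtain ⟨μ, hμ⟩ := exists_notMem_range_algebraMap h2
  have hl0 : l ≠ 0 := by
    rintro rfl
    have := pow_notMem_polySpan (K := K) (l := (0 : F)) (m := m) (by omega)
    rw [zero_pow hm0.ne'] at this
    exact this (Submodule.zero_mem _)
  rw [isFWS_iff, finrank_polySpanLine (by omega), h2]
  intro d hd
  rcases Nat.even_or_odd' d with ⟨e, rfl | rfl⟩
  · refine ⟨_, div_ne_zero (pow_ne_zero (m - e) hl0)
      (one_add_smul_pow_ne_zero (l := l) hμ (j := m - e) (by omega)), ?_⟩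
    rw [polySpanLine_inf_shift_div hl0 hμ hm (by omega), finrank_shift (pow_ne_zero _ hl0),
      finrank_restrictScalars_eq_mul, finrank_polySpan (by omega), h2]
    omega
  · refine ⟨_, pow_ne_zero (m - e) hl0, ?_⟩
    rw [polySpanLine_inf_shift_pow hm (j := m - e) (by omega) (by omega),
      finrank_shift (pow_ne_zero _ hl0), finrank_polySpanLine (by omega), h2]
    omega

end Tower

section Tower

variable {k K F : Type*} [Field k] [Field K] [Field F] [Algebra k K] [Algebra K F] [Algebra k F]
  [IsScalarTower k K F]

/-- A `λ`-invariant `K`-subspace is a `K(λ)`-subspace. -/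
theorem exists_restrictScalars_adjoin_eq [FiniteDimensional K F] {l : F}
    {T : IntermediateField K F} (hT : T = IntermediateField.adjoin K {l}) {U : Submodule K F}
    (hU : shift K l U ≤ U) :
    ∃ U' : Submodule T F, U'.restrictScalars K = U := by
  have hmul : ∀ x ∈ U, l * x ∈ U := fun x hx => hU (mul_mem_shift hx)
  refine ⟨{ U with smul_mem' := ?_ }, rfl⟩
  rintro ⟨t, ht⟩ x hx
  change t * x ∈ U
  have hint : IsIntegral K l := Algebra.IsIntegral.isIntegral l
  rw [hT, ← IntermediateField.mem_toSubalgebra,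
    IntermediateField.adjoin_simple_toSubalgebra_of_isAlgebraic hint.isAlgebraic] at ht
  induction ht using Algebra.adjoin_induction generalizing x with
  | mem y hy =>
    rw [Set.mem_singleton_iff] at hy
    exact hy ▸ hmul x hx
  | algebraMap r =>
    rw [← Algebra.smul_def]
    exact U.smul_mem r hx
  | add y z _ _ hy hz =>
    rw [add_mul]
    exact U.add_mem (hy hx) (hz hx)
  | mul y z _ _ hy hz =>
    rw [mul_assoc]
    exact hy (hz hx)

/-- If `S` lies in a shift of the field `K(λ)` and meets one of its own shifts in a line, then
both lie in the same shift of `K(λ)`, which is therefore large. -/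
theorem two_mul_finrank_le_of_finrank_inf_shift_eq_one [FiniteDimensional k F]
    (T : Submodule k F) (hT : ∀ x ∈ T, ∀ y ∈ T, x * y ∈ T) (hTi : ∀ x ∈ T, x⁻¹ ∈ T)
    {S : Submodule k F} {c : F} (hc : c ≠ 0) (hST : S ≤ shift k c T) {α : F} (hα : α ≠ 0)
    (hd : Module.finrank k ↥(S ⊓ shift k α S) = 1) :
    2 * Module.finrank k S ≤ Module.finrank k T + 1 := by
  have hbot : S ⊓ shift k α S ≠ ⊥ := by
    intro h
    rw [h, finrank_bot] at hd
    exact zero_ne_one hd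
  obtain ⟨x, ⟨hxS, hxα⟩, hx0⟩ := (Submodule.ne_bot_iff _).mp hbot
  have hx1 := (mem_shift_iff hc).mp (hST hxS)
  have hx2 := (mem_shift_iff hc).mp (hST ((mem_shift_iff hα).mp hxα))
  have hαT : α ∈ T := by
    convert hT _ hx1 _ (hTi _ hx2) using 1
    field_simp
  have hsup : S ⊔ shift k α S ≤ shift k c T := by
    refine sup_le hST ?_
    rintro _ ⟨y, hy, rfl⟩
    rw [mem_shift_iff hc, LinearMap.mulLeft_apply, mul_left_comm]
    exact hT _ hαT _ ((mem_shift_iff hc).mp (hST hy))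
  have h1 := Submodule.finrank_mono hsup
  have h2 := Submodule.finrank_sup_add_finrank_inf_eq S (shift k α S)
  rw [finrank_shift hα, hd] at h2
  rw [finrank_shift hc] at h1
  omega

theorem exists_shift_eq_polySpanLine [FiniteDimensional k F] [FiniteDimensional K F]
    (h2 : Module.finrank k K = 2) {B : Submodule K F} {b : F} (hb : b ∉ B)
    {m : ℕ} (hBm : Module.finrank K B = m) (hm : 0 < m)
    (hH : ∀ x : F, x ≠ 0 → shift K x (B ⊔ Submodule.span K {b}) = B ⊔ Submodule.span K {b} →
      x ∈ Set.range (algebraMap K F))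
    {S : Submodule k F} (hS : S = B.restrictScalars k ⊔ Submodule.span k {b})
    (hfws : ∀ d < 2 * m + 1, ∃ α : F, α ≠ 0 ∧ Module.finrank k ↥(S ⊓ shift k α S) = d) :
    ∃ α : F, α ≠ 0 ∧ ∃ l : F,
      2 * m + 1 ≤ Module.finrank K (IntermediateField.adjoin K {l}) ∧
      shift k α S = polySpanLine k K l m := by
  have hSr : Module.finrank k S = 2 * m + 1 := by
    rw [hS, finrank_sup_span_singleton_of_notMem (S := B.restrictScalars k) hb,
      finrank_restrictScalars_eq_mul, h2, hBm]
  have hVr : Module.finrank K ↥(B ⊔ Submodule.span K {b}) = m + 1 := by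
    rw [finrank_sup_span_singleton_of_notMem hb, hBm]
  have hBS : B.restrictScalars k ≤ S := hS ▸ le_sup_left
  obtain ⟨α, hα, hαd⟩ := hfws (2 * m - 1) (by omega)
  obtain ⟨l, hl, hlV, hlB⟩ := exists_shift_le_of_finrank_inf_shift_add_two h2 hb hH hS hα
    (by rw [hαd, hBm]; omega)
  obtain ⟨U, c, r, hU, hr, hB, hV⟩ := exists_eq_sup_shift_polySpan hl m B _ hBm hVr le_sup_left hlV
  have hSV : S ≤ (B ⊔ Submodule.span K {b}).restrictScalars k := by
    rw [hS]
    refine sup_le (fun x hx => Submodule.mem_sup_left hx) ?_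
    rw [Submodule.span_singleton_le_iff_mem]
    exact Submodule.mem_sup_right (Submodule.mem_span_singleton_self b)
  have hbV : b ∈ B ⊔ Submodule.span K {b} :=
    Submodule.mem_sup_right (Submodule.mem_span_singleton_self b)
  obtain ⟨T, hT⟩ : ∃ T, T = IntermediateField.adjoin K {l} := ⟨_, rfl⟩
  have hlT : l ∈ T := hT ▸ IntermediateField.mem_adjoin_simple_self K l
  have hlT_pow : ∀ i : ℕ, l ^ i ∈ T := fun i => pow_mem hlT i
  have : IsScalarTower k T F := ⟨fun a t x => smul_assoc a (t : F) x⟩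
  have hkT : Module.finrank k T = 2 * Module.finrank K T := by
    rw [← h2, Module.finrank_mul_finrank]
  rcases eq_or_ne U ⊥ with rfl | hU0
  · rw [finrank_bot, zero_add] at hr
    subst hr
    rw [bot_sup_eq] at hB
    rw [hV, bot_sup_eq] at hbV hSV
    obtain ⟨y, hy, hyb⟩ := hbV
    rw [LinearMap.mulLeft_apply] at hyb
    have hc : c ≠ 0 := by
      rintro rfl
      rw [zero_mul] at hyb
      exact hb (hyb ▸ B.zero_mem)
    rw [polySpan_succ] at hy
    obtain ⟨z, hz, w, hw, rfl⟩ := Submodule.mem_sup.mp hy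
    obtain ⟨κ, rfl⟩ := Submodule.mem_span_singleton.mp hw
    have hκ : κ ≠ 0 := by
      rintro rfl
      rw [zero_smul, add_zero] at hyb
      exact hb (hyb ▸ hB ▸ mul_mem_shift hz)
    have hκF : algebraMap K F κ ≠ 0 := by simpa using hκ
    refine ⟨algebraMap K F κ⁻¹ * c⁻¹, mul_ne_zero (by simpa using hκ) (inv_ne_zero hc), l, ?_, ?_⟩
    · obtain ⟨β, hβ, hβd⟩ := hfws 1 (by omega)
      have hPT : polySpan K l (m + 1) ≤ Subalgebra.toSubmodule T.toSubalgebra :=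
        polySpan_le_iff.mpr fun i _ => hlT_pow i
      have key := two_mul_finrank_le_of_finrank_inf_shift_eq_one
        ((Subalgebra.toSubmodule T.toSubalgebra).restrictScalars k)
        (fun x hx y hy => T.mul_mem hx hy) (fun x hx => T.inv_mem hx) hc
        (hSV.trans (shift_mono (R := k) c (S := (polySpan K l (m + 1)).restrictScalars k)
          hPT)) hβ hβd
      rw [hSr] at key
      change _ ≤ Module.finrank k T + 1 at key
      rw [← hT]
      omega
    · have hB' : shift K (algebraMap K F κ⁻¹ * c⁻¹) B = polySpan K l m := by
        rw [hB, ← shift_shift, shift_inv_shift hc,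
          shift_eq_self_of_mem_range (inv_ne_zero hκ)]
      have hb' : algebraMap K F κ⁻¹ * c⁻¹ * b = κ⁻¹ • z + l ^ m := by
        rw [← hyb, mul_assoc, inv_mul_cancel_left₀ hc, ← Algebra.smul_def, smul_add,
          inv_smul_smul₀ hκ]
      rw [hS, shift_sup, ← restrictScalars_shift, hB', shift_span_singleton, hb', polySpanLine]
      have hz' : κ⁻¹ • z ∈ (polySpan K l m).restrictScalars k := (polySpan K l m).smul_mem _ hz
      apply le_antisymm
      · refine sup_le le_sup_left ?_
        rw [Submodule.span_singleton_le_iff_mem]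
        exact Submodule.add_mem_sup hz' (Submodule.mem_span_singleton_self _)
      · refine sup_le le_sup_left ?_
        rw [Submodule.span_singleton_le_iff_mem]
        have := Submodule.add_mem_sup (neg_mem hz')
          (Submodule.mem_span_singleton_self (R := k) (κ⁻¹ • z + l ^ m))
        rwa [neg_add_cancel_left] at this
  · exfalso
    obtain ⟨U', rfl⟩ := exists_restrictScalars_adjoin_eq hT hU.le
    have hUB : U'.restrictScalars K ≤ B := by
      rw [hB]
      exact le_sup_left
    have hUpos : 0 < Module.finrank K ↥(U'.restrictScalars K) :=
      Nat.pos_of_ne_zero fun h => hU0 (Submodule.finrank_eq_zero.mp h)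
    have hVY : (B ⊔ Submodule.span K {b}) ≤ (U' ⊔ Submodule.span T {c}).restrictScalars K := by
      rw [hV]
      refine sup_le (fun x hx => Submodule.mem_sup_left hx) ?_
      rw [shift, Submodule.map_le_iff_le_comap, polySpan_le_iff]
      intro i _
      refine Submodule.mem_sup_right (Submodule.mem_span_singleton.mpr ⟨⟨l ^ i, ?_⟩, ?_⟩)
      · exact hlT_pow i
      · exact mul_comm _ _
    have hc : c ∉ U' := by
      intro hc
      refine hb (hUB ?_)
      have := hVY hbV
      rwa [sup_eq_left.mpr (by rwa [Submodule.span_singleton_le_iff_mem])] at this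
    have hYr : Module.finrank T ↥(U' ⊔ Submodule.span T {c}) = Module.finrank T U' + 1 :=
      finrank_sup_span_singleton_of_notMem hc
    have hlK : l ∉ Set.range (algebraMap K F) := by
      rintro ⟨x, rfl⟩
      exact hlB (shift_eq_self_of_mem_range (by simpa using hl) B)
    have hlt : B ⊔ Submodule.span K {b} < (U' ⊔ Submodule.span T {c}).restrictScalars K := by
      refine lt_of_le_of_ne hVY fun h => hlK (hH l hl ?_)
      rw [h]
      exact congrArg (Submodule.restrictScalars K)
        (shift_eq_self_of_mem_range (K := T) (x := ⟨l, hlT⟩)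
          (by simpa [Subtype.ext_iff] using hl) (U' ⊔ Submodule.span T {c}))
    have hltr := Submodule.finrank_lt_finrank_of_lt hlt
    rw [hVr, finrank_restrictScalars_eq_mul] at hltr
    have hUm := Submodule.finrank_mono hUB
    rw [hBm] at hUm
    rw [finrank_restrictScalars_eq_mul] at hUpos hUm
    obtain ⟨β, hβ, hβd⟩ := hfws (2 * (Module.finrank K T * Module.finrank T U') - 1) (by omega)
    refine finrank_inf_shift_add_one_ne (K := T) (hkT ▸ even_two_mul _) hYr (S := S)
      (fun x hx => hBS (hUB hx)) (fun x hx => hVY (hSV hx)) ?_ hβ ?_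
    · rw [hSr, hkT, mul_assoc]
      omega
    · rw [hβd, hkT, mul_assoc]
      omega

end Tower

end FWS

open FWS

/-- Theorem 6.2: for `S = S̄ ⊕ b F_q` with `S̄` an `F_{q^2}`-subspace of
dimension `l > 0`, `S̄ ∩ b F_{q^2} = {0}` and `H(⟨S⟩_{F_{q^2}}) = F_{q^2}`, the code `Orb(S)`
is FWS iff some cyclic shift of `S` equals `⟨1, λ, …, λ^(l-1)⟩_{F_{q^2}} ⊕ λ^l F_q` for a
`λ` with `[F_{q^2}(λ):F_{q^2}] ≥ 2l + 1`. -/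
theorem fws_small_case_classification
    {Fq F : Type*} [Field Fq] [Field F] [Algebra Fq F] [Fintype Fq] [Fintype F]
    (q n : ℕ) (hq : Fintype.card Fq = q) (hn : Module.finrank Fq F = n) (hneven : Even n)
    (T2 : IntermediateField Fq F) (hT2 : Module.finrank Fq ↥T2 = 2)
    (Sbar : Submodule ↥T2 F) (l : ℕ) (hSbar : Module.finrank ↥T2 ↥Sbar = l) (hl : 0 < l)
    (b : F) (hb : b ≠ 0) (hbS : Submodule.span ↥T2 {b} ⊓ Sbar = ⊥)
    (S : Submodule Fq F)
    (hS : S = Sbar.restrictScalars Fq ⊔ Submodule.span Fq {b})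
    (hSdim : Module.finrank Fq ↥S = 2 * l + 1)
    (hH : stab ((Submodule.span ↥T2 (S : Set F) : Submodule ↥T2 F) : Set F) = (T2 : Set F)) :
    IsFWS Fq S ↔
      ∃ α : F, α ≠ 0 ∧ ∃ lam : F,
        2 * l + 1 ≤ Module.finrank ↥T2 ↥(IntermediateField.adjoin ↥T2 {lam}) ∧
        shift Fq α S =
          (polySpan ↥T2 lam l).restrictScalars Fq ⊔ Submodule.span Fq {lam ^ l} := by
  have : FiniteDimensional Fq F := Module.Finite.of_finite
  have : FiniteDimensional T2 F := Module.Finite.of_finite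
  have hspan : Submodule.span T2 (S : Set F) = Sbar ⊔ Submodule.span T2 {b} := by
    apply le_antisymm
    · rw [Submodule.span_le, hS]
      intro x hx
      obtain ⟨y, hy, z, hz, rfl⟩ := Submodule.mem_sup.mp hx
      obtain ⟨a, rfl⟩ := Submodule.mem_span_singleton.mp hz
      rw [← algebraMap_smul T2 a b]
      exact Submodule.add_mem_sup hy (Submodule.smul_mem _ _ (Submodule.mem_span_singleton_self b))
    · have hle : Sbar.restrictScalars Fq ⊔ Submodule.span Fq {b} ≤ S := hS.ge
      refine sup_le (fun x hx => Submodule.subset_span (hle (Submodule.mem_sup_left hx))) ?_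
      rw [Submodule.span_singleton_le_iff_mem]
      exact Submodule.subset_span
        (hle (Submodule.mem_sup_right (Submodule.mem_span_singleton_self b)))
  have hbSbar : b ∉ Sbar := by
    intro h
    have hmem : b ∈ Submodule.span T2 {b} ⊓ Sbar := ⟨Submodule.mem_span_singleton_self b, h⟩
    rw [hbS] at hmem
    exact hb hmem
  constructor
  · intro hfws
    rw [isFWS_iff, hSdim] at hfws
    refine exists_shift_eq_polySpanLine hT2 hbSbar hSbar hl ?_ hS hfws
    intro x hx hxV
    have hxT : x ∈ stab ((Submodule.span T2 (S : Set F) : Submodule T2 F) : Set F) := by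
      refine Or.inl ⟨hx, ?_⟩
      rw [hspan]
      exact congrArg (SetLike.coe) hxV
    rw [hH] at hxT
    exact ⟨⟨x, hxT⟩, rfl⟩
  · rintro ⟨α, hα, lam, hlam, hshift⟩
    apply isFWS_of_isFWS_shift hα
    rw [hshift]
    exact isFWS_polySpanLine hT2 hl hlam
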